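/- arXiv:2507.06365 — 2 statements merged into one kernel-verified Lean document; each statement's English description precedes it below -/
import Mathlib

section
/- Let X ∈ L(A,K) be a covector and v ∈ F_X ∩ K. Then for every tope T of L(A,K), X∘T is a tope with X ≤ X∘T and (v,T) ∼ (v, X∘T); consequently, the fiber π^{-1}(v) of π : Z(A,K) → K is a finite set in bijection with the set of topes T of L(A,K) satisfying X ≤ T, via T ↦ [(v,T)]. -/
/-- Composition of sign vectors: `(X ∘ Y) e = X e` if `X e ≠ 0`, and `Y e` otherwise. -/
def scomp {E : Type*} (X Y : E → SignType) : E → SignType :=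
  fun e => if X e = 0 then Y e else X e

/-- The partial order on sign vectors: `X ≤ Y` iff `X ∘ Y = Y`. -/
def sle {E : Type*} (X Y : E → SignType) : Prop := scomp X Y = Y

theorem sle_refl {E : Type*} (X : E → SignType) : sle X X := by
  funext e; show (if X e = 0 then X e else X e) = X e; split <;> rfl

theorem sle_trans {E : Type*} {X Y Z : E → SignType} (h₁ : sle X Y) (h₂ : sle Y Z) :
    sle X Z := by
  funext e
  have h1 := congrFun h₁ e
  have h2 := congrFun h₂ e
  revert h1 h2
  show (if X e = 0 then Y e else X e) = Y e → (if Y e = 0 then Z e else Y e) = Z e →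
    (if X e = 0 then Z e else X e) = Z e
  generalize X e = a; generalize Y e = b; generalize Z e = c
  revert a b c; decide

theorem sle_antisymm {E : Type*} {X Y : E → SignType} (h₁ : sle X Y) (h₂ : sle Y X) :
    X = Y := by
  funext e
  have h1 := congrFun h₁ e
  have h2 := congrFun h₂ e
  revert h1 h2
  show (if X e = 0 then Y e else X e) = Y e → (if Y e = 0 then X e else Y e) = X e → X e = Y e
  generalize X e = a; generalize Y e = b
  revert a b; decide

/-- The separating set of two sign vectors: the indices where they take opposite
nonzero signs. -/
def SepSet {E : Type*} (X Y : E → SignType) : Set E :=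
  {e | (X e = 1 ∧ Y e = -1) ∨ (X e = -1 ∧ Y e = 1)}

section Geometry

variable {E : Type*} {V : Type*} [NormedAddCommGroup V] [NormedSpace ℝ V]

/-- The face of a sign vector `X`, relative to the family of cooriented affine hyperplanes
`H_e = {v | f e v = 0}`, with positive side `H_e⁺ = {v | f e v > 0}` and negative side
`H_e⁻ = {v | f e v < 0}`. -/
def face (f : E → (V →ᵃ[ℝ] ℝ)) (X : E → SignType) : Set V :=
  {v | ∀ e, SignType.sign (f e v) = X e}

/-- The conditional oriented matroid `L(A,K)`: the set of sign vectors whose face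
meets `K`. -/
def covs (f : E → (V →ᵃ[ℝ] ℝ)) (K : Set V) : Set (E → SignType) :=
  {X | (face f X ∩ K).Nonempty}

/-- A tope of `L(A,K)`: a maximal covector. -/
def IsTope (f : E → (V →ᵃ[ℝ] ℝ)) (K : Set V) (T : E → SignType) : Prop :=
  T ∈ covs f K ∧ ∀ Y ∈ covs f K, sle T Y → Y = T

/-- The set of topes of `L(A,K)`, as a type carrying the discrete topology. -/
def Topes (f : E → (V →ᵃ[ℝ] ℝ)) (K : Set V) : Type _ := {T : E → SignType // IsTope f K T}

instance (f : E → (V →ᵃ[ℝ] ℝ)) (K : Set V) : TopologicalSpace (Topes f K) := ⊥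

instance (f : E → (V →ᵃ[ℝ] ℝ)) (K : Set V) : DiscreteTopology (Topes f K) := ⟨rfl⟩

/-- Points of `K × T(A,K)`. -/
abbrev ZPre (f : E → (V →ᵃ[ℝ] ℝ)) (K : Set V) : Type _ := K × Topes f K

/-- The gluing relation defining `Z(A,K)`: `(v,T) ∼ (v',T')` iff `v = v'` and `v` lies on
no hyperplane separating `T` from `T'`. -/
def ZRel (f : E → (V →ᵃ[ℝ] ℝ)) (K : Set V) : ZPre f K → ZPre f K → Prop :=
  fun p q => (p.1 : V) = (q.1 : V) ∧ ∀ e ∈ SepSet p.2.1 q.2.1, f e (p.1 : V) ≠ 0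

/-- The space `Z(A,K)`: one copy of `K` for each tope, glued along the complement of the
separating hyperplanes, with the quotient topology. -/
def ZSpace (f : E → (V →ᵃ[ℝ] ℝ)) (K : Set V) : Type _ := Quot (ZRel f K)

instance (f : E → (V →ᵃ[ℝ] ℝ)) (K : Set V) : TopologicalSpace (ZSpace f K) :=
  inferInstanceAs (TopologicalSpace (Quot (ZRel f K)))

/-- The projection `π : Z(A,K) → V` (with image `K`), sending `[(v,T)]` to `v`. -/
def Zproj (f : E → (V →ᵃ[ℝ] ℝ)) (K : Set V) : ZSpace f K → V :=
  Quot.lift (fun p => (p.1 : V)) (fun _ _ h => h.1)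

/-- The set `K_{X,T} = K ∩ ⋂_{e : X_e = 0} H_e^{T_e}`. -/
def KXT (f : E → (V →ᵃ[ℝ] ℝ)) (K : Set V) (X T : E → SignType) : Set V :=
  K ∩ ⋂ e ∈ {e | X e = 0}, {v | SignType.sign (f e v) = T e}

/-- The subset `U_{X,T} ⊆ Z(A,K)`: the image of `K_{X,T} × {T}` under the quotient map. -/
def UXT (f : E → (V →ᵃ[ℝ] ℝ)) (K : Set V) (X : E → SignType) (T : Topes f K) :
    Set (ZSpace f K) :=
  {z | ∃ (v : V) (hv : v ∈ K), v ∈ KXT f K X T.1 ∧ z = Quot.mk (ZRel f K) (⟨v, hv⟩, T)}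

/-- The complexified complement `M(A,K)`, where `V ⊗ ℂ` is modeled as `V × V` (real and
imaginary parts): `v + iw` lies on `H_e ⊗ ℂ` iff `f e v = 0` and the linear part of `f e`
vanishes on `w`. -/
def MSpace (f : E → (V →ᵃ[ℝ] ℝ)) (K : Set V) : Type _ :=
  {p : V × V // p.1 ∈ K ∧ ∀ e, ¬(f e p.1 = 0 ∧ (f e).linear p.2 = 0)}

instance (f : E → (V →ᵃ[ℝ] ℝ)) (K : Set V) : TopologicalSpace (MSpace f K) :=
  inferInstanceAs (TopologicalSpace {p : V × V // p.1 ∈ K ∧ _})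

/-- The projection `ρ : M(A,K) → V` (with image `K`), sending `v + iw` to `v`. -/
def Mproj (f : E → (V →ᵃ[ℝ] ℝ)) (K : Set V) : MSpace f K → V := fun p => p.1.1

end Geometry

variable {V : Type*} [NormedAddCommGroup V] [NormedSpace ℝ V] [FiniteDimensional ℝ V]
variable {E : Type*} [Fintype E]

open Filter Topology in
/-- Moving slightly from a point of `F_X ∩ K` in a direction `u` gives the covector obtained by
composing `X` with the signs of the linear parts at `u`. -/
theorem scomp_sign_linear_mem_covs {V E : Type*} [NormedAddCommGroup V] [NormedSpace ℝ V]
    [Finite E] {f : E → (V →ᵃ[ℝ] ℝ)} {K : Set V} (hK : IsOpen K) {X : E → SignType} {v : V}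
    (hvX : v ∈ face f X) (hvK : v ∈ K) (u : V) :
    scomp X (fun e => SignType.sign ((f e).linear u)) ∈ covs f K := by
  have hline : ∀ (e : E) (t : ℝ), f e (t • u + v) = t * (f e).linear u + f e v := by
    intro e t
    have h := (f e).map_vadd v (t • u)
    simpa using h
  have hmem : ∀ᶠ t : ℝ in 𝓝[>] 0, t • u + v ∈ K := by
    have hc : Continuous fun t : ℝ => t • u + v := by fun_prop
    exact (hc.continuousAt.eventually_mem (hK.mem_nhds (by simpa using hvK))).filter_mono
      nhdsWithin_le_nhds
  have hsign : ∀ᶠ t : ℝ in 𝓝[>] 0, ∀ e, SignType.sign (f e (t • u + v)) =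
      scomp X (fun e => SignType.sign ((f e).linear u)) e := by
    refine eventually_all.2 fun e => ?_
    have hXe := hvX e
    simp only [hline, scomp, ← hXe, sign_eq_zero_iff]
    have hc : Continuous fun t : ℝ => t * (f e).linear u + f e v := by fun_prop
    rcases lt_trichotomy (f e v) 0 with h | h | h
    · have := (hc.tendsto' 0 (f e v) (by simp)).eventually_lt_const h
      filter_upwards [this.filter_mono nhdsWithin_le_nhds] with t ht
      rw [if_neg h.ne, sign_neg ht, sign_neg h]
    · filter_upwards [self_mem_nhdsWithin] with t ht
      rw [if_pos h, h, add_zero, sign_mul, sign_pos ht, one_mul]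
    · have := (hc.tendsto' 0 (f e v) (by simp)).eventually_const_lt h
      filter_upwards [this.filter_mono nhdsWithin_le_nhds] with t ht
      rw [if_neg h.ne', sign_pos ht, sign_pos h]
  obtain ⟨t, ht, ht'⟩ := (hmem.and hsign).exists
  exact ⟨t • u + v, ht', ht⟩

theorem sle_scomp {E : Type*} (X Y : E → SignType) : sle X (scomp X Y) := by
  funext e
  by_cases h : X e = 0 <;> simp [scomp, h]

theorem IsTope.apply_ne_zero {V E : Type*} [NormedAddCommGroup V] [NormedSpace ℝ V] [Finite E]
    {f : E → (V →ᵃ[ℝ] ℝ)} (hf : ∀ e, (f e).linear ≠ 0) {K : Set V} (hK : IsOpen K)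
    {T : E → SignType} (hT : IsTope f K T) (e : E) : T e ≠ 0 := by
  intro h0
  obtain ⟨w, hwT, hwK⟩ := hT.1
  obtain ⟨u, hu⟩ := DFunLike.ne_iff.1 (hf e)
  have h := congrFun (hT.2 _ (scomp_sign_linear_mem_covs hK hwT hwK u) (sle_scomp _ _)) e
  simp only [scomp, h0, if_true, sign_eq_zero_iff] at h
  exact hu h

theorem isTope_of_apply_ne_zero {V E : Type*} [NormedAddCommGroup V] [NormedSpace ℝ V]
    {f : E → (V →ᵃ[ℝ] ℝ)} {K : Set V} {T : E → SignType} (hT : T ∈ covs f K)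
    (h0 : ∀ e, T e ≠ 0) : IsTope f K T := by
  refine ⟨hT, fun Y _ hY => ?_⟩
  funext e
  simpa [scomp, h0 e] using (congrFun hY e).symm

theorem scomp_mem_covs {V E : Type*} [NormedAddCommGroup V] [NormedSpace ℝ V] [Finite E]
    {f : E → (V →ᵃ[ℝ] ℝ)} {K : Set V} (hK : IsOpen K) {X Y : E → SignType}
    {v : V} (hvX : v ∈ face f X) (hvK : v ∈ K) (hY : Y ∈ covs f K) : scomp X Y ∈ covs f K := by
  obtain ⟨w, hwY, -⟩ := hY
  convert scomp_sign_linear_mem_covs hK hvX hvK (w - v) using 1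
  funext e
  have hXe := hvX e
  by_cases h : X e = 0
  · have hv : f e v = 0 := by rwa [h, sign_eq_zero_iff] at hXe
    have hl : (f e).linear (w - v) = f e w - f e v := by
      simpa using (f e).linearMap_vsub w v
    simp only [scomp, h, if_true]
    rw [hl, hv, sub_zero, hwY e]
  · simp [scomp, h]

theorem ZRel.scomp_eq {V E : Type*} [NormedAddCommGroup V] [NormedSpace ℝ V] [Finite E]
    {f : E → (V →ᵃ[ℝ] ℝ)} (hf : ∀ e, (f e).linear ≠ 0) {K : Set V} (hK : IsOpen K)
    {p q : ZPre f K} (h : ZRel f K p q) :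
    scomp (fun e => SignType.sign (f e p.1)) p.2.1 =
      scomp (fun e => SignType.sign (f e q.1)) q.2.1 := by
  funext e
  simp only [scomp, ← h.1, sign_eq_zero_iff]
  split_ifs with h0
  · have hsep : e ∉ SepSet p.2.1 q.2.1 := fun he => h.2 e he h0
    have hp := p.2.2.apply_ne_zero hf hK e
    have hq := q.2.2.apply_ne_zero hf hK e
    simp only [SepSet, Set.mem_ofPred_eq] at hsep
    revert hsep hp hq
    generalize p.2.1 e = a
    generalize q.2.1 e = b
    revert a b
    decide
  · rfl

theorem zRel_scomp {V E : Type*} [NormedAddCommGroup V] [NormedSpace ℝ V]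
    {f : E → (V →ᵃ[ℝ] ℝ)} {K : Set V} {X T : E → SignType} {v : V} (hvX : v ∈ face f X)
    (hvK : v ∈ K) (hT : IsTope f K T) (hT' : IsTope f K (scomp X T)) :
    ZRel f K (⟨v, hvK⟩, ⟨T, hT⟩) (⟨v, hvK⟩, ⟨scomp X T, hT'⟩) := by
  refine ⟨rfl, fun e he h0 => ?_⟩
  replace h0 : f e v = 0 := h0
  have hX0 : X e = 0 := by rw [← hvX e, h0, sign_zero]
  simp only [SepSet, Set.mem_ofPred_eq, scomp, hX0, if_true] at he
  revert he
  generalize T e = a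
  revert a
  decide

/-- Let `X ∈ L(A,K)` and `v ∈ F_X ∩ K`.  For every tope `T`, `X∘T` is a tope with
`X ≤ X∘T` and `(v,T) ∼ (v,X∘T)`; consequently the fiber `π⁻¹(v)` is finite and in
bijection with the set of topes `T` with `X ≤ T`, via `T ↦ [(v,T)]`. -/
theorem fiber_biject_topes_above
    (f : E → (V →ᵃ[ℝ] ℝ)) (hf : ∀ e, (f e).linear ≠ 0)
    (K : Set V) (hKne : K.Nonempty) (hKconv : Convex ℝ K) (hKopen : IsOpen K)
    (X : E → SignType) (hX : X ∈ covs f K)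
    (v : V) (hvX : v ∈ face f X) (hvK : v ∈ K) :
    (∀ T : E → SignType, ∀ hT : IsTope f K T, ∃ hT' : IsTope f K (scomp X T),
      sle X (scomp X T) ∧ ZRel f K (⟨v, hvK⟩, ⟨T, hT⟩) (⟨v, hvK⟩, ⟨scomp X T, hT'⟩)) ∧
    (Zproj f K ⁻¹' {v}).Finite ∧
    Function.Bijective (fun T : {T : E → SignType // IsTope f K T ∧ sle X T} =>
      (⟨Quot.mk (ZRel f K) (⟨v, hvK⟩, ⟨T.1, T.2.1⟩), rfl⟩ :
        {z : ZSpace f K // Zproj f K z = v})) := by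
  have hcomp : ∀ T, IsTope f K T → IsTope f K (scomp X T) := fun T hT =>
    isTope_of_apply_ne_zero (scomp_mem_covs hKopen hvX hvK hT.1) fun e => by
      have := hT.apply_ne_zero hf hKopen e
      by_cases h : X e = 0 <;> simp [scomp, h, this]
  have hsurj : Function.Surjective (fun T : {T : E → SignType // IsTope f K T ∧ sle X T} =>
      (⟨Quot.mk (ZRel f K) (⟨v, hvK⟩, ⟨T.1, T.2.1⟩), rfl⟩ :
        {z : ZSpace f K // Zproj f K z = v})) := by
    rintro ⟨z, hz⟩
    induction z using Quot.ind with
    | mk p =>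
      obtain ⟨⟨w, hwK⟩, T, hT⟩ := p
      obtain rfl : w = v := hz
      exact ⟨⟨scomp X T, hcomp T hT, sle_scomp X T⟩,
        Subtype.ext (Quot.sound (zRel_scomp hvX hvK hT (hcomp T hT))).symm⟩
  refine ⟨fun T hT => ⟨hcomp T hT, sle_scomp X T, zRel_scomp hvX hvK hT _⟩, ?_, ?_, hsurj⟩
  · have : Finite {z : ZSpace f K // Zproj f K z = v} := Finite.of_surjective _ hsurj
    exact Set.finite_coe_iff.1 this
  · rintro ⟨T, hT, hXT⟩ ⟨T', hT', hXT'⟩ h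
    have h' := congrArg (fun z : {z : ZSpace f K // Zproj f K z = v} =>
      Quot.lift (r := ZRel f K) (fun p => scomp (fun e => SignType.sign (f e p.1)) p.2.1)
        (fun _ _ => ZRel.scomp_eq hf hKopen) z.1) h
    have hX' : (fun e => SignType.sign (f e v)) = X := funext hvX
    change scomp (fun e => SignType.sign (f e v)) T =
      scomp (fun e => SignType.sign (f e v)) T' at h'
    rw [hX', hXT, hXT'] at h'
    exact Subtype.ext h'
end

section
/- For any covector X ∈ L(A,K) and any tope T of L(A,K), the quotient map K × T(A,K) → Z(A,K) restricts to a homeomorphism from K_{X,T} × {T} onto the open subset U_{X,T} of Z(A,K); in particular U_{X,T} is homeomorphic to the convex open set K_{X,T} and hence contractible. -/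
variable {V : Type*} [NormedAddCommGroup V] [NormedSpace ℝ V] [FiniteDimensional ℝ V]
variable {E : Type*} [Fintype E]

omit [FiniteDimensional ℝ V] in
/-- Topes have no zero entries. -/
theorem IsTope.ne_zero {f : E → (V →ᵃ[ℝ] ℝ)} (hf : ∀ e, (f e).linear ≠ 0) {K : Set V}
    (hKopen : IsOpen K) {T : E → SignType} (hT : IsTope f K T) (e : E) : T e ≠ 0 := by
  intro he
  obtain ⟨⟨v, hvT, hvK⟩, hmax⟩ := hT
  obtain ⟨w, hw⟩ : ∃ w, (f e).linear w ≠ 0 := by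
    by_contra! h
    exact hf e (LinearMap.ext h)
  have hcont : Continuous fun t : ℝ => v + t • w := by fun_prop
  have hval (d : E) (t : ℝ) : f d (v + t • w) = f d v + t * (f d).linear w := by
    have h := (f d).map_vadd v (t • w)
    simp only [vadd_eq_add, map_smul, smul_eq_mul] at h
    rw [add_comm v, h, add_comm]
  have hK : ∀ᶠ t in nhds (0 : ℝ), v + t • w ∈ K :=
    hcont.continuousAt.eventually_mem (hKopen.mem_nhds (by simpa using hvK))
  have hsign : ∀ᶠ t in nhds (0 : ℝ), ∀ d, T d ≠ 0 →
      SignType.sign (f d (v + t • w)) = T d := by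
    refine Filter.eventually_all.2 fun d => ?_
    by_cases hd : T d = 0
    · simp [hd]
    have hfd : Continuous fun t : ℝ => f d (v + t • w) := by
      simp only [hval]; fun_prop
    have h0 : f d (v + (0 : ℝ) • w) ≠ 0 := by
      rw [zero_smul, add_zero, ← sign_ne_zero, hvT d]; exact hd
    have hloc := (continuousAt_sign_of_ne_zero h0).comp_of_eq hfd.continuousAt rfl
    filter_upwards [hloc.eventually_mem ((isOpen_discrete {T d}).mem_nhds
      (by simpa using hvT d))] with t ht _
    exact ht
  obtain ⟨t, ⟨htK, htS⟩, ht0⟩ := (((hK.and hsign).filter_mono nhdsWithin_le_nhds).and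
    (self_mem_nhdsWithin : {(0 : ℝ)}ᶜ ∈ nhdsWithin 0 {(0 : ℝ)}ᶜ)).exists
  have hY := hmax (fun d => SignType.sign (f d (v + t • w))) ⟨_, fun _ => rfl, htK⟩ <| by
    funext d
    by_cases hd : T d = 0
    · simp [scomp, hd]
    · simp [scomp, hd, htS d hd]
  have hve : f e v = 0 := by rw [← sign_eq_zero_iff, hvT e, he]
  have h := congrFun hY e
  simp only [he, sign_eq_zero_iff, hval, hve, zero_add] at h
  exact mul_ne_zero ht0 hw h

omit [FiniteDimensional ℝ V] in
theorem zRel_iff {f : E → (V →ᵃ[ℝ] ℝ)} (hf : ∀ e, (f e).linear ≠ 0) {K : Set V}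
    (hKopen : IsOpen K) {p q : ZPre f K} :
    ZRel f K p q ↔ p.1 = q.1 ∧ ∀ e, f e (p.1 : V) = 0 → p.2.1 e = q.2.1 e := by
  refine and_congr Subtype.ext_iff.symm (forall_congr' fun e => ?_)
  have hp := p.2.2.ne_zero hf hKopen e
  have hq := q.2.2.ne_zero hf hKopen e
  have key : e ∈ SepSet p.2.1 q.2.1 ↔ p.2.1 e ≠ q.2.1 e := by
    simp only [SepSet, Set.mem_ofPred_eq]
    revert hp hq
    generalize p.2.1 e = a
    generalize q.2.1 e = b
    revert a b
    decide
  rw [key]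
  tauto

omit [FiniteDimensional ℝ V] in
theorem zRel_equivalence {f : E → (V →ᵃ[ℝ] ℝ)} (hf : ∀ e, (f e).linear ≠ 0) {K : Set V}
    (hKopen : IsOpen K) : Equivalence (ZRel f K) where
  refl _ := (zRel_iff hf hKopen).2 ⟨rfl, fun _ _ => rfl⟩
  symm h := by
    rw [zRel_iff hf hKopen] at h ⊢
    exact ⟨h.1.symm, fun e he => (h.2 e (h.1 ▸ he)).symm⟩
  trans h₁ h₂ := by
    rw [zRel_iff hf hKopen] at h₁ h₂ ⊢
    exact ⟨h₁.1.trans h₂.1, fun e he => (h₁.2 e he).trans (h₂.2 e (h₁.1 ▸ he))⟩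

theorem isOpen_KXT {f : E → (V →ᵃ[ℝ] ℝ)} {K : Set V} (hKopen : IsOpen K)
    (X : E → SignType) {T : E → SignType} (hT : ∀ e, T e ≠ 0) : IsOpen (KXT f K X T) := by
  refine hKopen.inter (Set.Finite.isOpen_biInter (Set.toFinite _) fun e _ => ?_)
  have hcont : Continuous (f e) := (f e).continuous_of_finiteDimensional
  obtain h | h | h := SignType.trichotomy (T e)
  · simpa [h, sign_eq_neg_one_iff] using isOpen_lt hcont continuous_const
  · exact absurd h (hT e)
  · simpa [h, sign_eq_one_iff] using isOpen_lt continuous_const hcont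

omit [FiniteDimensional ℝ V] [Fintype E] in
theorem convex_KXT {f : E → (V →ᵃ[ℝ] ℝ)} {K : Set V} (hKconv : Convex ℝ K)
    (X T : E → SignType) : Convex ℝ (KXT f K X T) := by
  refine hKconv.inter (convex_iInter₂ fun e _ => ?_)
  obtain h | h | h := SignType.trichotomy (T e)
  · simpa [h, sign_eq_neg_one_iff, Set.preimage] using (convex_Iio (0 : ℝ)).affine_preimage (f e)
  · simpa [h, sign_eq_zero_iff, Set.preimage] using (convex_singleton (0 : ℝ)).affine_preimage (f e)
  · simpa [h, sign_eq_one_iff, Set.preimage] using (convex_Ioi (0 : ℝ)).affine_preimage (f e)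

omit [FiniteDimensional ℝ V] [Fintype E] in
theorem continuous_Zproj (f : E → (V →ᵃ[ℝ] ℝ)) (K : Set V) : Continuous (Zproj f K) :=
  continuous_coinduced_dom.2 (continuous_subtype_val.comp continuous_fst)

/-- The quotient map `K × T(A,K) → Z(A,K)`. -/
def ZSpace.mk (f : E → (V →ᵃ[ℝ] ℝ)) (K : Set V) : ZPre f K → ZSpace f K :=
  Quot.mk (ZRel f K)

omit [FiniteDimensional ℝ V] [Fintype E] in
theorem ZSpace.continuous_mk (f : E → (V →ᵃ[ℝ] ℝ)) (K : Set V) :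
    Continuous (ZSpace.mk f K) :=
  continuous_quot_mk

theorem isOpen_UXT {f : E → (V →ᵃ[ℝ] ℝ)} (hf : ∀ e, (f e).linear ≠ 0) {K : Set V}
    (hKopen : IsOpen K) (X : E → SignType) (T : Topes f K) : IsOpen (UXT f K X T) := by
  have hpre : ZSpace.mk f K ⁻¹' UXT f K X T =
      {p : ZPre f K | (p.1 : V) ∈ KXT f K X T.1} ∩
        {p : ZPre f K | ∀ e ∈ SepSet p.2.1 T.1, f e (p.1 : V) ≠ 0} := by
    ext p
    constructor
    · rintro ⟨v, hv, hvX, hz⟩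
      obtain ⟨h, hsep⟩ := (zRel_equivalence hf hKopen).quot_mk_eq_iff _ _ |>.1 hz
      exact ⟨by simpa [h] using hvX, hsep⟩
    · rintro ⟨hvX, hsep⟩
      exact ⟨p.1, p.1.2, hvX, Quot.sound ⟨rfl, hsep⟩⟩
  refine isOpen_coinduced.2 ?_
  change IsOpen (ZSpace.mk f K ⁻¹' UXT f K X T)
  rw [hpre]
  refine ((isOpen_KXT hKopen X (T.2.ne_zero hf hKopen)).preimage
    (continuous_subtype_val.comp continuous_fst)).inter ?_
  have hne (e : E) : IsOpen {v : K | f e (v : V) ≠ 0} :=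
    isOpen_ne_fun ((f e).continuous_of_finiteDimensional.comp continuous_subtype_val)
      continuous_const
  simp only [Set.ofPred_forall]
  refine isOpen_iInter_of_finite fun e => ?_
  simp only [imp_iff_not_or, Set.ofPred_or]
  exact ((isOpen_discrete {S : Topes f K | e ∉ SepSet S.1 T.1}).preimage continuous_snd).union
    ((hne e).preimage continuous_fst)

omit [FiniteDimensional ℝ V] [Fintype E] in
theorem Zproj_mem_KXT {f : E → (V →ᵃ[ℝ] ℝ)} {K : Set V} {X : E → SignType} {T : Topes f K}
    {z : ZSpace f K} (hz : z ∈ UXT f K X T) : Zproj f K z ∈ KXT f K X T.1 := by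
  obtain ⟨v, hv, hvX, rfl⟩ := hz
  exact hvX

/-- The projection restricts to a homeomorphism `U_{X,T} ≃ₜ K_{X,T}`. -/
def UXT.homeomorph (f : E → (V →ᵃ[ℝ] ℝ)) (K : Set V) (X : E → SignType) (T : Topes f K) :
    UXT f K X T ≃ₜ KXT f K X T.1 where
  toFun z := ⟨Zproj f K z.1, Zproj_mem_KXT z.2⟩
  invFun v := ⟨ZSpace.mk f K (⟨v, v.2.1⟩, T), v, v.2.1, v.2, rfl⟩
  left_inv := by rintro ⟨_, v, hv, hvX, h⟩; subst h; rfl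
  right_inv _ := rfl
  continuous_toFun := ((continuous_Zproj f K).comp continuous_subtype_val).subtype_mk _
  continuous_invFun := ((ZSpace.continuous_mk f K).comp (by fun_prop)).subtype_mk _

/-- The slice `K_{X,T} × {T}` of `K × T(A,K)` is homeomorphic to `K_{X,T}`. -/
def KXT.sliceHomeomorph (f : E → (V →ᵃ[ℝ] ℝ)) (K : Set V) (X : E → SignType)
    (T : Topes f K) :
    {p : ZPre f K // (p.1 : V) ∈ KXT f K X T.1 ∧ p.2 = T} ≃ₜ KXT f K X T.1 where
  toFun p := ⟨p.1.1, p.2.1⟩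
  invFun v := ⟨(⟨v, v.2.1⟩, T), v.2, rfl⟩
  left_inv := by rintro ⟨⟨v, T'⟩, hv, rfl⟩; rfl
  right_inv _ := rfl
  continuous_toFun := by fun_prop
  continuous_invFun := by fun_prop

/-- For any covector `X ∈ L(A,K)` and tope `T`, the quotient map `K × T(A,K) → Z(A,K)`
restricts to a homeomorphism from `K_{X,T} × {T}` onto the open subset `U_{X,T}`; in
particular `U_{X,T}` is homeomorphic to the convex open set `K_{X,T}`, hence
contractible. -/
theorem UXT_open_homeo_contractible
    (f : E → (V →ᵃ[ℝ] ℝ)) (hf : ∀ e, (f e).linear ≠ 0)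
    (K : Set V) (hKne : K.Nonempty) (hKconv : Convex ℝ K) (hKopen : IsOpen K)
    (X : E → SignType) (hX : X ∈ covs f K) (T : Topes f K) :
    IsOpen (UXT f K X T) ∧
    IsHomeomorph (fun q : {p : ZPre f K // (p.1 : V) ∈ KXT f K X T.1 ∧ p.2 = T} =>
      (⟨Quot.mk (ZRel f K) q.1, q.1.1.1, q.1.1.2, q.2.1,
        congrArg (fun t => Quot.mk (ZRel f K) (q.1.1, t)) q.2.2⟩ :
        ↥(UXT f K X T))) ∧
    Nonempty (↥(UXT f K X T) ≃ₜ ↥(KXT f K X T.1)) ∧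
    ContractibleSpace ↥(UXT f K X T) := by
  refine ⟨isOpen_UXT hf hKopen X T, ?_, ⟨UXT.homeomorph f K X T⟩, ?_⟩
  · convert ((KXT.sliceHomeomorph f K X T).trans (UXT.homeomorph f K X T).symm).isHomeomorph
      using 1
    funext ⟨⟨v, T'⟩, hv, hT⟩
    subst hT
    rfl
  · obtain ⟨t, htT, htK⟩ := T.2.1
    have hne : (KXT f K X T.1).Nonempty := ⟨t, htK, Set.mem_iInter₂.2 fun e _ => htT e⟩
    have := (convex_KXT (f := f) hKconv X T.1).contractibleSpace hne
    exact (UXT.homeomorph f K X T).contractibleSpace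
end
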